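/- For every p in the simplex Δ, the set Γ_k(p) of global minimizers over ℝ^n of the expected surrogate loss u ↦ Σ_{y∈Y} p_y L_k(u,y) equals the Minkowski sum conv{𝟙_S : S ∈ γ_k(p)} + { −w : w in the convex cone generated by {e_i : p_i = 0} } + { α·𝟙 : α ∈ ℝ }. -/

import Mathlib

open scoped NNReal

def simplex (n : ℕ) : Set (Fin n → ℝ) := {p | (∀ i, 0 ≤ p i) ∧ ∑ i, p i = 1}

noncomputable def sigmaTop (n m : ℕ) (u : Fin n → ℝ) : ℝ :=
  if h : ((Finset.univ : Finset (Fin n)).powersetCard m).Nonempty then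
    ((Finset.univ : Finset (Fin n)).powersetCard m).sup' h (fun S => ∑ i ∈ S, u i)
  else 0

noncomputable def Lk (n k : ℕ) (u : Fin n → ℝ) (y : Fin n) : ℝ :=
  if h : (Finset.Icc 1 n).Nonempty then
    (Finset.Icc 1 n).sup' h
      (fun m => sigmaTop n m u / (m : ℝ) + max 0 (1 - (k : ℝ) / (m : ℝ))) - u y
  else 0

def indic {n : ℕ} (S : Finset (Fin n)) : Fin n → ℝ := fun i => if i ∈ S then 1 else 0

noncomputable def nthLarge {n : ℕ} (v : Fin n → ℝ) (j : ℕ) : ℝ :=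
  if h : n - j < n then v (Tuple.sort v ⟨n - j, h⟩) else 0

noncomputable def L2 (n k : ℕ) (u : Fin n → ℝ) (y : Fin n) : ℝ :=
  max 0 (1 - u y + (1 / (k : ℝ)) * sigmaTop n k (u - Pi.single y 1))

noncomputable def L3 (n k : ℕ) (u : Fin n → ℝ) (y : Fin n) : ℝ :=
  (1 / (k : ℝ)) * ∑ i ∈ Finset.Icc 1 k, max 0 (1 - u y + nthLarge (u - Pi.single y 1) i)

noncomputable def sigmaExcl (n k : ℕ) (u : Fin n → ℝ) (y : Fin n) : ℝ :=
  if h : ((Finset.univ.erase y).powersetCard k).Nonempty then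
    ((Finset.univ.erase y).powersetCard k).sup' h (fun S => ∑ i ∈ S, u i)
  else 0

noncomputable def L4 (n k : ℕ) (u : Fin n → ℝ) (y : Fin n) : ℝ :=
  max 0 (1 - u y + (1 / (k : ℝ)) * sigmaExcl n k u y)

noncomputable def ell2 (k : ℕ) {n : ℕ} (H M : Finset (Fin n)) (y : Fin n) : ℝ :=
  if y ∈ H then 0
  else if y ∈ M then ((H.card : ℝ) + M.card - 1) / ((k : ℝ) - H.card)
  else ((H.card : ℝ) + M.card - 1) / ((k : ℝ) - H.card) + ((k : ℝ) + 1) / k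

noncomputable def ell4 (k : ℕ) {n : ℕ} (T : Finset (Fin n)) (y : Fin n) : ℝ :=
  if y ∈ T then 0 else ((k : ℝ) + 1) / ((k : ℝ) + 1 - T.card)


theorem exists_sum_eq_sigmaTop {n m : ℕ} (hm : m ≤ n) (u : Fin n → ℝ) :
    ∃ S : Finset (Fin n), S.card = m ∧ ∑ i ∈ S, u i = sigmaTop n m u := by
  have h : ((Finset.univ : Finset (Fin n)).powersetCard m).Nonempty :=
    Finset.powersetCard_nonempty.2 (by simpa using hm)
  obtain ⟨S, hS, hSu⟩ := Finset.exists_mem_eq_sup' h (fun S => ∑ i ∈ S, u i)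
  refine ⟨S, (Finset.mem_powersetCard.1 hS).2, ?_⟩
  rw [sigmaTop, dif_pos h, hSu]

theorem sum_le_sigmaTop {n m : ℕ} (u : Fin n → ℝ) {S : Finset (Fin n)} (hS : S.card = m) :
    ∑ i ∈ S, u i ≤ sigmaTop n m u := by
  have hmem : S ∈ (Finset.univ : Finset (Fin n)).powersetCard m :=
    Finset.mem_powersetCard.2 ⟨Finset.subset_univ _, hS⟩
  rw [sigmaTop, dif_pos ⟨S, hmem⟩]
  exact Finset.le_sup' (fun S => ∑ i ∈ S, u i) hmem

/-- The label-independent part of `Lk` is the least `b` dominating all normalized set scores. -/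
theorem exists_Lk_eq_sub {n : ℕ} (k : ℕ) (hn : 1 ≤ n) (u : Fin n → ℝ) :
    ∃ c : ℝ, (∀ y, Lk n k u y = c - u y) ∧ ∀ b : ℝ, c ≤ b ↔
      ∀ S : Finset (Fin n), S.Nonempty →
        ∑ i ∈ S, u i + max 0 ((S.card : ℝ) - k) ≤ b * S.card := by
  have h : (Finset.Icc 1 n).Nonempty := ⟨1, by simpa using hn⟩
  have key (s b : ℝ) (m : ℕ) (hm : 1 ≤ m) :
      s / (m : ℝ) + max 0 (1 - (k : ℝ) / m) ≤ b ↔ s + max 0 ((m : ℝ) - k) ≤ b * m := by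
    have hm0 : (0 : ℝ) < m := by exact_mod_cast hm
    have hmax : max 0 ((m : ℝ) - k) = max 0 (1 - (k : ℝ) / m) * m := by
      rw [max_mul_of_nonneg _ _ hm0.le]
      congr 1
      · ring
      · field_simp
    rw [hmax, ← mul_le_mul_iff_left₀ hm0, add_mul, div_mul_cancel₀ _ hm0.ne']
  refine ⟨(Finset.Icc 1 n).sup' h
      (fun m => sigmaTop n m u / (m : ℝ) + max 0 (1 - (k : ℝ) / (m : ℝ))),
    fun y => by rw [Lk, dif_pos h], fun b => ?_⟩
  rw [Finset.sup'_le_iff]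
  constructor
  · intro hb S hS
    have hcard : S.card ≤ n := by simpa using S.card_le_univ
    have := (key _ b _ hS.card_pos).1 (hb S.card (Finset.mem_Icc.2 ⟨hS.card_pos, hcard⟩))
    linarith [sum_le_sigmaTop u (S := S) rfl]
  · intro hb m hm
    obtain ⟨hm1, hmn⟩ := Finset.mem_Icc.1 hm
    obtain ⟨S, rfl, hS⟩ := exists_sum_eq_sigmaTop hmn u
    rw [key _ b _ hm1, ← hS]
    exact hb S (Finset.card_pos.1 hm1)

/-- A set of maximal sum among those of its cardinality contains the largest coordinates. -/
theorem le_of_sum_eq_sigmaTop {n m : ℕ} {q : Fin n → ℝ} {T : Finset (Fin n)} (hT : T.card = m)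
    (hTq : ∑ i ∈ T, q i = sigmaTop n m q) {i j : Fin n} (hi : i ∈ T) (hj : j ∉ T) :
    q j ≤ q i := by
  have hj' : j ∉ T.erase i := fun h => hj (Finset.mem_of_mem_erase h)
  have hcard : (insert j (T.erase i)).card = m := by
    rw [Finset.card_insert_of_notMem hj', Finset.card_erase_add_one hi, hT]
  have := sum_le_sigmaTop q hcard
  rw [Finset.sum_insert hj'] at this
  linarith [Finset.add_sum_erase T q hi]

/-- A linear bound on uniform weights extends to all nonnegative weights `q`, by peeling off
the uniform weight on the support of `q`. -/
theorem weighted_sum_le {ι : Type*} [Fintype ι] [DecidableEq ι] {k : ℕ} {u : ι → ℝ} {c : ℝ}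
    (hc : ∀ S : Finset ι, S.Nonempty →
      ∑ i ∈ S, u i + max 0 ((S.card : ℝ) - k) ≤ c * S.card)
    {T : Finset ι} (hT : T.card = k) (q : ι → ℝ) (hq : ∀ i, 0 ≤ q i)
    (hTq : ∀ i ∈ T, ∀ j ∉ T, q j ≤ q i) :
    ∑ i, q i * u i + ∑ i, q i - ∑ i ∈ T, q i ≤ c * ∑ i, q i := by
  induction hN : (Finset.univ.filter fun i => q i ≠ 0).card using Nat.strong_induction_on
    generalizing q with
  | _ N ih =>
    set S := Finset.univ.filter fun i => q i ≠ 0 with hS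
    have memS (i : ι) : i ∈ S ↔ q i ≠ 0 := by simp [hS]
    rcases S.eq_empty_or_nonempty with hemp | hne
    · have hq0 (i : ι) : q i = 0 := by
        by_contra h
        simpa [hemp] using (memS i).2 h
      simp [hq0]
    obtain ⟨a, haS, hmin⟩ := S.exists_min_image q hne
    have hapos : 0 < q a := lt_of_le_of_ne (hq a) (Ne.symm ((memS a).1 haS))
    set q' : ι → ℝ := fun i => q i - if i ∈ S then q a else 0 with hq'
    have hout {i : ι} (hi : i ∉ S) : q i = 0 := by simpa [memS] using hi
    have hnn (i : ι) : 0 ≤ q' i := by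
      by_cases hi : i ∈ S
      · simpa [hq', hi] using hmin i hi
      · simpa [hq', hi] using hq i
    have hord : ∀ i ∈ T, ∀ j ∉ T, q' j ≤ q' i := by
      intro i hi j hj
      have hij := hTq i hi j hj
      by_cases hjS : j ∈ S
      · have hiS : i ∈ S := by
          by_contra h
          rw [hout h] at hij
          exact (memS j).1 hjS (le_antisymm hij (hq j))
        simpa [hq', hjS, hiS] using hij
      · have : q' j = 0 := by simp [hq', hjS, hout hjS]
        rw [this]
        exact hnn i
    have hlt : (Finset.univ.filter fun i => q' i ≠ 0).card < N := by
      rw [← hN]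
      refine Finset.card_lt_card (Finset.ssubset_iff_of_subset ?_ |>.2 ⟨a, haS, ?_⟩)
      · intro i hi
        by_contra h
        simp [hq', h, hout h] at hi
      · simp [hq', haS]
    have IH := ih _ hlt q' hnn hord rfl
    have e1 : ∑ i, q' i * u i = ∑ i, q i * u i - q a * ∑ i ∈ S, u i := by
      simp [hq', sub_mul, Finset.sum_sub_distrib, ite_mul, Finset.mul_sum]
    have e2 : ∑ i, q' i = ∑ i, q i - q a * S.card := by
      simp [hq', Finset.sum_sub_distrib, mul_comm]
    have e3 : ∑ i ∈ T, q' i = ∑ i ∈ T, q i - q a * (T ∩ S).card := by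
      simp [hq', Finset.sum_sub_distrib, Finset.sum_ite_mem, mul_comm]
    have hmeet : (S.card : ℝ) - (T ∩ S).card ≤ max 0 ((S.card : ℝ) - k) := by
      by_cases hsub : S ⊆ T
      · simp [Finset.inter_eq_right.2 hsub]
      · obtain ⟨j, hjS, hjT⟩ := Finset.not_subset.1 hsub
        have hTS : T ⊆ S := fun i hi => (memS i).2 fun h0 =>
          (memS j).1 hjS (le_antisymm (h0 ▸ hTq i hi j hjT) (hq j))
        rw [Finset.inter_eq_left.2 hTS, hT]
        exact le_max_right _ _
    have hSc : ∑ i ∈ S, u i + (S.card : ℝ) - (T ∩ S).card ≤ c * S.card := by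
      linarith [hc S hne]
    rw [e1, e2, e3] at IH
    nlinarith [mul_le_mul_of_nonneg_left hSc hapos.le]

theorem one_sub_sigmaTop_le {n k : ℕ} (hkn : k ≤ n) {u : Fin n → ℝ} {c : ℝ}
    (hc : ∀ S : Finset (Fin n), S.Nonempty →
      ∑ i ∈ S, u i + max 0 ((S.card : ℝ) - k) ≤ c * S.card)
    {q : Fin n → ℝ} (hq : q ∈ simplex n) :
    1 - sigmaTop n k q ≤ c - ∑ i, q i * u i := by
  obtain ⟨T, hT, hTq⟩ := exists_sum_eq_sigmaTop hkn q
  have := weighted_sum_le hc hT q hq.1 fun i hi j hj => le_of_sum_eq_sigmaTop hT hTq hi hj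
  rw [hq.2, hTq] at this
  linarith

theorem mem_span_single_iff {n : ℕ} (Z : Fin n → Prop) (w : Fin n → ℝ) :
    w ∈ Submodule.span ℝ≥0 {x : Fin n → ℝ | ∃ i, Z i ∧ x = Pi.single i 1} ↔
      (∀ i, 0 ≤ w i) ∧ ∀ i, ¬ Z i → w i = 0 := by
  constructor
  · intro hw
    induction hw using Submodule.span_induction with
    | mem x hx =>
      obtain ⟨i, hi, rfl⟩ := hx
      refine ⟨fun j => ?_, fun j hj => Pi.single_eq_of_ne (by rintro rfl; exact hj hi) _⟩
      by_cases h : j = i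
      · subst h; simp
      · simp [Pi.single_eq_of_ne h]
    | zero => simp
    | add x y _ _ hx hy =>
      exact ⟨fun i => add_nonneg (hx.1 i) (hy.1 i), fun i hi => by simp [hx.2 i hi, hy.2 i hi]⟩
    | smul a x _ hx =>
      exact ⟨fun i => by simpa [NNReal.smul_def] using mul_nonneg a.2 (hx.1 i),
        fun i hi => by simp [hx.2 i hi]⟩
  · rintro ⟨h0, hZ⟩
    have hw : w = ∑ i, (⟨w i, h0 i⟩ : ℝ≥0) • (Pi.single i 1 : Fin n → ℝ) := by
      ext j
      simp [Finset.sum_apply, Pi.single_apply]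
    rw [hw]
    refine Submodule.sum_mem _ fun i _ => ?_
    by_cases hi : Z i
    · exact Submodule.smul_mem _ _ (Submodule.subset_span ⟨i, hi, rfl⟩)
    · have : (⟨w i, h0 i⟩ : ℝ≥0) = 0 := Subtype.ext (hZ i hi)
      rw [this, zero_smul]
      exact Submodule.zero_mem _

theorem sum_mul_indic {n : ℕ} (q : Fin n → ℝ) (S : Finset (Fin n)) :
    ∑ i, q i * indic S i = ∑ i ∈ S, q i := by
  simp [indic]

theorem sum_mul_eq_of_mem_convexHull {n k : ℕ} {p g : Fin n → ℝ}
    (hg : g ∈ convexHull ℝ {x : Fin n → ℝ | ∃ S : Finset (Fin n),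
      S.card = k ∧ (∑ i ∈ S, p i) = sigmaTop n k p ∧ x = indic S}) :
    ∑ i, p i * g i = sigmaTop n k p := by
  have hconv : Convex ℝ {x : Fin n → ℝ | ∑ i, p i * x i = sigmaTop n k p} := by
    intro x hx y hy a b _ _ hab
    simp only [Set.mem_ofPred_eq] at hx hy ⊢
    have : ∑ i, p i * (a • x + b • y) i = a * ∑ i, p i * x i + b * ∑ i, p i * y i := by
      simp only [Finset.mul_sum, ← Finset.sum_add_distrib]
      exact Finset.sum_congr rfl fun i _ => by simp; ring
    rw [this, hx, hy, ← add_mul, hab, one_mul]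
  refine convexHull_min ?_ hconv hg
  rintro _ ⟨S, -, hS, rfl⟩
  simp only [Set.mem_ofPred_eq, sum_mul_indic, hS]

theorem sum_le_of_mem_convexHull {n k : ℕ} {p g : Fin n → ℝ}
    (hg : g ∈ convexHull ℝ {x : Fin n → ℝ | ∃ S : Finset (Fin n),
      S.card = k ∧ (∑ i ∈ S, p i) = sigmaTop n k p ∧ x = indic S}) (R : Finset (Fin n)) :
    ∑ i ∈ R, g i ≤ R.card - max 0 ((R.card : ℝ) - k) := by
  have hconv : Convex ℝ {x : Fin n → ℝ | ∑ i ∈ R, x i ≤ R.card - max 0 ((R.card : ℝ) - k)} := by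
    refine convex_halfSpace_le ⟨fun x y => ?_, fun a x => ?_⟩ _
    · simp [Finset.sum_add_distrib]
    · simp [Finset.mul_sum]
  refine convexHull_min ?_ hconv hg
  rintro _ ⟨S, hS, -, rfl⟩
  have h1 : ((R ∩ S).card : ℝ) ≤ R.card := by
    exact_mod_cast Finset.card_le_card Finset.inter_subset_left
  have h2 : ((R ∩ S).card : ℝ) ≤ k := by
    exact_mod_cast hS ▸ Finset.card_le_card Finset.inter_subset_right
  have h3 : ∑ i ∈ R, indic S i = (R ∩ S).card := by simp [indic, Finset.sum_ite_mem]
  simp only [Set.mem_ofPred_eq, h3]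
  rcases max_cases 0 ((R.card : ℝ) - k) with h | h <;> linarith

/-- For small `t > 0` the top-`k` sum of `p + t • d` is controlled by the top-`k` subsets of `p`. -/
theorem eventually_sigmaTop_add_smul_le {n k : ℕ} (hkn : k ≤ n) (p d : Fin n → ℝ) (M : ℝ)
    (hM : ∀ S : Finset (Fin n), S.card = k → ∑ i ∈ S, p i = sigmaTop n k p →
      ∑ i ∈ S, d i ≤ M) :
    ∀ᶠ t : ℝ in nhdsWithin 0 (Set.Ioi 0),
      sigmaTop n k (p + t • d) ≤ sigmaTop n k p + t * M := by
  have hall : ∀ᶠ t : ℝ in nhdsWithin 0 (Set.Ioi 0), ∀ S : Finset (Fin n), S.card = k →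
      ∑ i ∈ S, p i + t * ∑ i ∈ S, d i ≤ sigmaTop n k p + t * M := by
    refine Filter.eventually_all.2 fun S => ?_
    by_cases hS : S.card = k
    swap
    · exact Filter.Eventually.of_forall fun t h => absurd h hS
    rcases (sum_le_sigmaTop p hS).eq_or_lt with heq | hlt
    · filter_upwards [self_mem_nhdsWithin] with t ht _
      rw [heq]
      have := mul_le_mul_of_nonneg_left (hM S hS heq) (le_of_lt ht)
      linarith
    · have hcont : Filter.Tendsto (fun t : ℝ => sigmaTop n k p + t * M -
          (∑ i ∈ S, p i + t * ∑ i ∈ S, d i)) (nhds 0)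
          (nhds (sigmaTop n k p + 0 * M - (∑ i ∈ S, p i + 0 * ∑ i ∈ S, d i))) :=
        Continuous.tendsto (by fun_prop) 0
      have := hcont.eventually_const_lt (u := 0) (by linarith)
      filter_upwards [nhdsWithin_le_nhds this] with t ht _
      linarith
  filter_upwards [hall] with t ht
  obtain ⟨S, hS, hSe⟩ := exists_sum_eq_sigmaTop hkn (p + t • d)
  rw [← hSe]
  simpa [Finset.sum_add_distrib, Finset.mul_sum] using ht S hS

theorem eventually_add_smul_mem_simplex {n : ℕ} {p d : Fin n → ℝ} (hp : p ∈ simplex n)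
    (hd : ∑ i, d i = 0) (hd0 : ∀ i, p i = 0 → 0 ≤ d i) :
    ∀ᶠ t : ℝ in nhdsWithin 0 (Set.Ioi 0), p + t • d ∈ simplex n := by
  have hall : ∀ᶠ t : ℝ in nhdsWithin 0 (Set.Ioi 0), ∀ i, 0 ≤ p i + t * d i := by
    refine Filter.eventually_all.2 fun i => ?_
    rcases (hp.1 i).eq_or_lt with h0 | hpos
    · filter_upwards [self_mem_nhdsWithin] with t ht
      rw [← h0, zero_add]
      exact mul_nonneg (le_of_lt ht) (hd0 i h0.symm)
    · have hcont : Filter.Tendsto (fun t : ℝ => p i + t * d i) (nhds 0)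
          (nhds (p i + 0 * d i)) := Continuous.tendsto (by fun_prop) 0
      have := hcont.eventually_const_lt (u := 0) (by linarith)
      filter_upwards [nhdsWithin_le_nhds this] with t ht using ht.le
  filter_upwards [hall] with t ht
  refine ⟨fun i => by simpa using ht i, ?_⟩
  simp [Finset.sum_add_distrib, ← Finset.mul_sum, hd, hp.2]

/-- A subgradient of the top-`k` sum restricted to the simplex is the sum of a subgradient of the
top-`k` sum and a normal vector to the simplex. -/
theorem exists_decomposition_of_subgradient {n k : ℕ} (hkn : k ≤ n) {p : Fin n → ℝ}
    (hp : p ∈ simplex n) {u : Fin n → ℝ}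
    (hu : ∀ q ∈ simplex n,
      ∑ i, q i * u i - sigmaTop n k q ≤ ∑ i, p i * u i - sigmaTop n k p) :
    ∃ g ∈ convexHull ℝ {x : Fin n → ℝ | ∃ S : Finset (Fin n),
        S.card = k ∧ (∑ i ∈ S, p i) = sigmaTop n k p ∧ x = indic S},
      ∃ α : ℝ, (∀ i, u i ≤ g i + α) ∧ ∀ i, p i ≠ 0 → u i = g i + α := by
  set G := {x : Fin n → ℝ | ∃ S : Finset (Fin n),
    S.card = k ∧ (∑ i ∈ S, p i) = sigmaTop n k p ∧ x = indic S} with hG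
  obtain ⟨j, hj⟩ : ∃ j, p j ≠ 0 := by
    by_contra! h
    simpa [h] using hp.2
  set N : Set (Fin n → ℝ) := {y | ∀ i, u i - y i ≤ u j - y j ∧
    (p i ≠ 0 → u j - y j ≤ u i - y i)} with hN
  by_cases hdisj : Disjoint (convexHull ℝ G) N
  swap
  · obtain ⟨g, hg, hgN⟩ := Set.not_disjoint_iff.1 hdisj
    refine ⟨g, hg, u j - g j, fun i => ?_, fun i hi => ?_⟩
    · linarith [(hgN i).1]
    · linarith [(hgN i).1, (hgN i).2 hi]
  exfalso
  have hGfin : G.Finite := (Set.finite_range (indic (n := n))).subset (by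
    rintro _ ⟨S, -, -, rfl⟩
    exact ⟨S, rfl⟩)
  have hNconv : Convex ℝ N := by
    intro x hx y hy a b ha hb hab i
    have hb' : b = 1 - a := by linarith
    subst hb'
    simp only [Pi.add_apply, Pi.smul_apply, smul_eq_mul]
    refine ⟨?_, fun hi => ?_⟩
    · nlinarith [mul_le_mul_of_nonneg_left (hx i).1 ha, mul_le_mul_of_nonneg_left (hy i).1 hb]
    · nlinarith [mul_le_mul_of_nonneg_left ((hx i).2 hi) ha,
        mul_le_mul_of_nonneg_left ((hy i).2 hi) hb]
  have hNclosed : IsClosed N := by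
    simp only [hN, Set.ofPred_forall, Set.ofPred_and]
    refine isClosed_iInter fun i => (isClosed_le (by fun_prop) (by fun_prop)).inter ?_
    exact isClosed_iInter fun _ => isClosed_le (by fun_prop) (by fun_prop)
  obtain ⟨f, a, b, hfa, hab, hfb⟩ := geometric_hahn_banach_compact_closed
    (convex_convexHull ℝ G) (hGfin.isCompact_convexHull ℝ) hNconv hNclosed hdisj
  set d : Fin n → ℝ := fun i => f (Pi.single i 1) with hd
  have hf (x : Fin n → ℝ) : f x = ∑ i, x i * d i := by
    conv_lhs => rw [pi_eq_sum_univ' x]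
    simp [hd]
  have nonneg_of_bdd {r : ℝ} (h : ∀ s : ℝ, 0 ≤ s → b < f u + s * r) : 0 ≤ r := by
    by_contra! hr
    have h0 := h 0 le_rfl
    have := h ((f u - b) / -r) (div_nonneg (by linarith) (by linarith))
    rw [div_mul_eq_mul_div, mul_div_assoc, div_neg, div_self hr.ne] at this
    linarith
  have hu_add (s : ℝ) (x : Fin n → ℝ) (hx : u + s • x ∈ N) : b < f u + s * f x := by
    simpa using hfb _ hx
  have hone : 0 ≤ f (fun _ => 1) := nonneg_of_bdd fun s _ => hu_add s _ fun i => by simp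
  have hnegone : 0 ≤ f (-fun _ => 1) := nonneg_of_bdd fun s _ => hu_add s _ fun i => by simp
  have hdsum : ∑ i, d i = 0 := by
    have h1 : f (fun _ => 1) = ∑ i, d i := by simp [hf]
    rw [map_neg] at hnegone
    linarith
  have hd0 (i : Fin n) (hi : p i = 0) : 0 ≤ d i := by
    refine nonneg_of_bdd fun s hs => hu_add s _ fun l => ?_
    have hji : j ≠ i := fun h => hj (h ▸ hi)
    by_cases hl : l = i
    · subst hl
      simp [hji, hs, hi]
    · simp [hji, hl]
  have hM (S : Finset (Fin n)) (hS : S.card = k) (hSp : ∑ i ∈ S, p i = sigmaTop n k p) :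
      ∑ i ∈ S, d i ≤ a := by
    have := hfa _ (subset_convexHull ℝ G ⟨S, hS, hSp, rfl⟩)
    rw [hf] at this
    simp only [mul_comm _ (d _), sum_mul_indic] at this
    exact this.le
  obtain ⟨t, ⟨ht1, ht2⟩, ht0⟩ := (((eventually_sigmaTop_add_smul_le hkn p d a hM).and
    (eventually_add_smul_mem_simplex hp hdsum hd0)).and self_mem_nhdsWithin).exists
  have hlt : a < f u := hab.trans (hfb u fun i => by simp)
  have hq := hu _ ht2
  have e : ∑ i, (p + t • d) i * u i = ∑ i, p i * u i + t * f u := by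
    rw [hf, Finset.mul_sum, ← Finset.sum_add_distrib]
    exact Finset.sum_congr rfl fun i _ => by simp; ring
  rw [e] at hq
  nlinarith [mul_lt_mul_of_pos_left hlt ht0]

theorem stmt1 (n k : ℕ) (hk : 1 ≤ k) (hkn : k < n) (p : Fin n → ℝ) (hp : p ∈ simplex n) :
    {u : Fin n → ℝ | ∀ v : Fin n → ℝ,
        ∑ y, p y * Lk n k u y ≤ ∑ y, p y * Lk n k v y} =
      {u : Fin n → ℝ | ∃ g ∈ convexHull ℝ
          {x : Fin n → ℝ | ∃ S : Finset (Fin n),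
            S.card = k ∧ (∑ i ∈ S, p i) = sigmaTop n k p ∧ x = indic S},
        ∃ w ∈ (Submodule.span ℝ≥0
            {x : Fin n → ℝ | ∃ i, p i = 0 ∧ x = Pi.single i 1} : Set (Fin n → ℝ)),
        ∃ α : ℝ, u = g - w + α • (fun _ => (1 : ℝ))} := by
  have hkn' := hkn.le
  choose c hcL hc using fun u : Fin n → ℝ => exists_Lk_eq_sub k (hk.trans hkn') u
  have hloss (u : Fin n → ℝ) : ∑ y, p y * Lk n k u y = c u - ∑ y, p y * u y := by
    simp only [hcL, mul_sub, Finset.sum_sub_distrib, ← Finset.sum_mul, hp.2, one_mul]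
  have hlow (u q : Fin n → ℝ) (hq : q ∈ simplex n) :
      1 - sigmaTop n k q ≤ c u - ∑ y, q y * u y :=
    one_sub_sigmaTop_le hkn' ((hc u _).1 le_rfl) hq
  have hatt {g w : Fin n → ℝ} (α : ℝ) (hg : g ∈ convexHull ℝ
      {x : Fin n → ℝ | ∃ S : Finset (Fin n),
        S.card = k ∧ (∑ i ∈ S, p i) = sigmaTop n k p ∧ x = indic S})
      (hw : ∀ i, 0 ≤ w i) (hw0 : ∀ i, p i ≠ 0 → w i = 0) :
      c (g - w + α • (fun _ : Fin n => (1 : ℝ))) - ∑ y, p y * (g - w + α • (fun _ : Fin n => (1 : ℝ))) y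
        ≤ 1 - sigmaTop n k p := by
    have hpw : ∑ y, p y * w y = 0 := Finset.sum_eq_zero fun i _ => by
      by_cases hi : p i = 0
      · simp [hi]
      · simp [hw0 i hi]
    have hpu : ∑ y, p y * (g - w + α • (fun _ : Fin n => (1 : ℝ))) y = sigmaTop n k p + α := by
      simp [mul_add, mul_sub, Finset.sum_add_distrib, ← Finset.sum_mul, hp.2, hpw,
        sum_mul_eq_of_mem_convexHull hg]
    have hcu : c (g - w + α • (fun _ : Fin n => (1 : ℝ))) ≤ 1 + α := by
      refine (hc _ _).2 fun R _ => ?_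
      have hR := sum_le_of_mem_convexHull hg R
      have hwR : 0 ≤ ∑ i ∈ R, w i := Finset.sum_nonneg fun i _ => hw i
      simp [Finset.sum_add_distrib]
      linarith
    linarith
  ext u
  simp only [Set.mem_ofPred_eq, hloss, SetLike.mem_coe, mem_span_single_iff]
  constructor
  · intro hmin
    obtain ⟨S, hS, hSp⟩ := exists_sum_eq_sigmaTop hkn' p
    have hle := (hmin _).trans (hatt (w := 0) 0 (subset_convexHull ℝ _ ⟨S, hS, hSp, rfl⟩)
      (fun _ => le_rfl) fun _ _ => rfl)
    obtain ⟨g, hg, α, h1, h2⟩ := exists_decomposition_of_subgradient hkn' hp (u := u)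
      fun q hq => by linarith [hlow u q hq]
    refine ⟨g, hg, fun i => g i + α - u i, ⟨fun i => by linarith [h1 i],
      fun i hi => by linarith [h2 i hi]⟩, α, ?_⟩
    ext i
    simp only [Pi.add_apply, Pi.sub_apply, Pi.smul_apply, smul_eq_mul]
    ring
  · rintro ⟨g, hg, w, ⟨hw, hw0⟩, α, rfl⟩ v
    exact (hatt α hg hw hw0).trans (hlow v p hp)
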